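/- arXiv:1307.0070 — 3 statements merged into one kernel-verified Lean document; each statement's English description precedes it below -/
import Mathlib

section
/- Let G be a finitely generated group and m, l ∈ G. Then R(G,m,l) is a closed subset of ℝ². -/
open Real

/-- `SU(2)`: the group of 2×2 complex special unitary matrices, as a subgroup of the
unitary group. -/
noncomputable def SU2 : Subgroup (Matrix.unitaryGroup (Fin 2) ℂ) where
  carrier := {A | (A : Matrix (Fin 2) (Fin 2) ℂ).det = 1}
  one_mem' := by simp
  mul_mem' := by
    intro a b ha hb
    simp only [Set.mem_setOf_eq] at *
    simp only [Matrix.UnitaryGroup.mul_apply] at *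
    rw [Matrix.det_mul, ha, hb, mul_one]
  inv_mem' := by
    intro a ha
    simp only [Set.mem_setOf_eq] at *
    have h : ((a⁻¹ : Matrix.unitaryGroup (Fin 2) ℂ) : Matrix (Fin 2) (Fin 2) ℂ)
        = star (a : Matrix (Fin 2) (Fin 2) ℂ) := rfl
    rw [h]
    simp [Matrix.star_eq_conjTranspose, Matrix.det_conjTranspose, ha]

/-- The underlying matrix of an element of `SU(2)`. -/
noncomputable def SU2.mat (A : SU2) : Matrix (Fin 2) (Fin 2) ℂ :=
  ((A : Matrix.unitaryGroup (Fin 2) ℂ) : Matrix (Fin 2) (Fin 2) ℂ)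

/-- The diagonal matrix `diag(e^{iθ}, e^{-iθ})`. -/
noncomputable def Dmat (θ : ℝ) : Matrix (Fin 2) (Fin 2) ℂ :=
  Matrix.diagonal ![Complex.exp (θ * Complex.I), Complex.exp (-θ * Complex.I)]

theorem Dmat_mem_unitary (θ : ℝ) : Dmat θ ∈ Matrix.unitaryGroup (Fin 2) ℂ := by
  constructor <;>
  · ext i j
    fin_cases i <;> fin_cases j <;>
      simp [Dmat, Matrix.mul_apply, Fin.sum_univ_two, Matrix.diagonal,
        Matrix.conjTranspose_apply, ← Complex.exp_conj, ← Complex.exp_add, Complex.exp_zero,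
        mul_comm]

theorem Dmat_det (θ : ℝ) : (Dmat θ).det = 1 := by
  simp [Dmat, Matrix.det_diagonal, Fin.prod_univ_two, ← Complex.exp_add]

/-- `D(θ) = diag(e^{iθ}, e^{-iθ})` as an element of `SU(2)`. -/
noncomputable def DSU (θ : ℝ) : SU2 := ⟨⟨Dmat θ, Dmat_mem_unitary θ⟩, Dmat_det θ⟩

/-- The pillowcase set `R(G,m,l)`: pairs `(θ, η)` such that some homomorphism
`ρ : G → SU(2)` satisfies `ρ(m) = D(θ)` and `ρ(l) = D(η)`. -/
def RSet (G : Type*) [Group G] (m l : G) : Set (ℝ × ℝ) :=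
  {x | ∃ ρ : G →* SU2, ρ m = DSU x.1 ∧ ρ l = DSU x.2}

theorem Matrix.isCompact_unitaryGroup (n : Type*) [Fintype n] [DecidableEq n] :
    IsCompact (Matrix.unitaryGroup n ℂ : Set (Matrix n n ℂ)) := by
  have hbox : IsCompact {A : Matrix n n ℂ | ∀ i, A i ∈ {v : n → ℂ | ∀ j, v j ∈
      Metric.closedBall (0 : ℂ) 1}} :=
    isCompact_pi_infinite fun _ => isCompact_pi_infinite fun _ => isCompact_closedBall 0 1
  refine hbox.of_isClosed_subset isClosed_unitary fun A hA i j => ?_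
  simpa using entry_norm_bound_of_unitary hA i j

instance SU2.instCompactSpace : CompactSpace SU2 := by
  have : CompactSpace (Matrix.unitaryGroup (Fin 2) ℂ) :=
    isCompact_iff_compactSpace.mp (Matrix.isCompact_unitaryGroup (Fin 2))
  have hclosed : IsClosed (SU2 : Set (Matrix.unitaryGroup (Fin 2) ℂ)) :=
    isClosed_eq (continuous_subtype_val.matrix_det) continuous_const
  exact isCompact_iff_compactSpace.mp hclosed.isCompact

theorem continuous_DSU : Continuous DSU := by
  refine Continuous.subtype_mk (Continuous.subtype_mk ?_ _) _
  refine Continuous.matrix_diagonal (continuous_pi fun i => ?_)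
  fin_cases i <;> simp <;> fun_prop

/-- For a finitely generated group `G` and `m, l ∈ G`, the set `R(G,m,l)` is a closed
subset of `ℝ²`. -/
theorem statement_1 (G : Type*) [Group G] [Group.FG G] (m l : G) :
    IsClosed (RSet G m l) := by
  have hclosed : IsClosed {p : (ℝ × ℝ) × (G → SU2) |
      p.2 ∈ Set.range ((↑) : (G →* SU2) → G → SU2) ∧
        p.2 m = DSU p.1.1 ∧ p.2 l = DSU p.1.2} := by
    refine ((MonoidHom.isClosed_range_coe G SU2).preimage continuous_snd).inter
      (IsClosed.inter (isClosed_eq ?_ ?_) (isClosed_eq ?_ ?_))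
    · fun_prop
    · exact continuous_DSU.comp (by fun_prop)
    · fun_prop
    · exact continuous_DSU.comp (by fun_prop)
  convert isClosedMap_fst_of_compactSpace _ hclosed using 1
  ext x
  constructor
  · rintro ⟨ρ, hm, hl⟩
    exact ⟨(x, ρ), ⟨⟨ρ, rfl⟩, hm, hl⟩, rfl⟩
  · rintro ⟨⟨_, _⟩, ⟨⟨ρ, rfl⟩, hm, hl⟩, rfl⟩
    exact ⟨ρ, hm, hl⟩
end

section
/- Let G be a group and m, l ∈ G. Suppose (i) the normal closure of m in G is all of G, and (ii) there exists a group homomorphism ρ₀ : G → SU(2) with image contained in {I, −I}, ρ₀(m) = −I and ρ₀(l) = I. Then every point (θ,η) ∈ R(G,m,l) with θ ∈ πℤ satisfies η ∈ 2πℤ. -/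
open Real

/-- A homomorphism agreeing on a normal generator with a homomorphism whose values are central
agrees with it everywhere. -/
theorem MonoidHom.eq_of_normalClosure_of_central {G H : Type*} [Group G] [Group H] {m : G}
    (hm : Subgroup.normalClosure ({m} : Set G) = ⊤) (ρ σ : G →* H)
    (hσ : ∀ g : G, σ g ∈ Subgroup.center H) (h : ρ m = σ m) : ρ = σ := by
  have hn : (ρ.eqLocus σ).Normal := by
    refine ⟨fun g hg x => ?_⟩
    have hg' : ρ g = σ g := hg
    change ρ (x * g * x⁻¹) = σ (x * g * x⁻¹)
    have hρ := Subgroup.mem_center_iff.mp (hσ g) (ρ x)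
    have hσx := Subgroup.mem_center_iff.mp (hσ g) (σ x)
    simp only [map_mul, map_inv, hg', hρ, hσx, mul_inv_cancel_right]
  have hle : Subgroup.normalClosure ({m} : Set G) ≤ ρ.eqLocus σ :=
    Subgroup.normalClosure_le_normal (Set.singleton_subset_iff.mpr h)
  ext1 g
  exact hle (hm ▸ Subgroup.mem_top g)

theorem SU2.mat_injective : Function.Injective SU2.mat :=
  fun _ _ h => Subtype.ext (Subtype.ext h)

theorem SU2.mat_mul (A B : SU2) : SU2.mat (A * B) = SU2.mat A * SU2.mat B := rfl

theorem SU2.mat_one : SU2.mat 1 = 1 := rfl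

theorem SU2.mem_center_of_mat {A : SU2} (h : SU2.mat A = 1 ∨ SU2.mat A = -1) :
    A ∈ Subgroup.center SU2 := by
  refine Subgroup.mem_center_iff.mpr fun B => SU2.mat_injective ?_
  rcases h with h | h <;> simp [SU2.mat_mul, h]

theorem mat_DSU (θ : ℝ) : SU2.mat (DSU θ) = Dmat θ := rfl

theorem eq_two_pi_mul_int_of_Dmat_eq_one {η : ℝ} (h : Dmat η = 1) :
    ∃ k : ℤ, η = 2 * π * (k : ℝ) := by
  have h0 : Complex.exp (η * Complex.I) = 1 := by
    simpa [Dmat] using congrFun (congrFun h 0) 0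
  obtain ⟨k, hk⟩ := Complex.exp_eq_one_iff.mp h0
  refine ⟨k, ?_⟩
  have := congrArg Complex.im hk
  simp at this
  linarith

theorem Dmat_int_mul_pi (k : ℤ) : Dmat (k * π) = 1 ∨ Dmat (k * π) = -1 := by
  have h1 : Complex.exp (((k * π : ℝ) : ℂ) * Complex.I) = (-1) ^ k := by
    rw [← Complex.exp_pi_mul_I, ← Complex.exp_int_mul]
    push_cast
    ring_nf
  have h2 : Complex.exp (-((k * π : ℝ) : ℂ) * Complex.I) = ((-1) ^ k)⁻¹ := by
    rw [neg_mul, Complex.exp_neg, h1]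
  unfold Dmat
  rw [h1, h2]
  rcases Int.even_or_odd k with hk | hk
  · left
    rw [hk.neg_one_zpow]
    ext i j
    fin_cases i <;> fin_cases j <;> simp
  · right
    rw [hk.neg_one_zpow]
    ext i j
    fin_cases i <;> fin_cases j <;> simp

/-- Suppose the normal closure of `m` is all of `G` and there is a homomorphism
`ρ₀ : G → SU(2)` with image in `{I, -I}`, `ρ₀(m) = -I`, `ρ₀(l) = I`.  Then every point
`(θ,η) ∈ R(G,m,l)` with `θ ∈ πℤ` satisfies `η ∈ 2πℤ`. -/
theorem statement_3 {G : Type*} [Group G] (m l : G)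
    (hm : Subgroup.normalClosure ({m} : Set G) = ⊤)
    (ρ₀ : G →* SU2)
    (hcentral : ∀ g : G, SU2.mat (ρ₀ g) = 1 ∨ SU2.mat (ρ₀ g) = -1)
    (hρm : SU2.mat (ρ₀ m) = -1) (hρl : SU2.mat (ρ₀ l) = 1) :
    ∀ θ η : ℝ, (θ, η) ∈ RSet G m l → (∃ k : ℤ, θ = (k : ℝ) * π) →
      ∃ k : ℤ, η = 2 * π * (k : ℝ) := by
  rintro θ η ⟨ρ, hθ, hη⟩ ⟨k, rfl⟩
  apply eq_two_pi_mul_int_of_Dmat_eq_one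
  rw [← mat_DSU, ← hη]
  rcases Dmat_int_mul_pi k with hk | hk
  · have h : ρ = 1 := MonoidHom.eq_of_normalClosure_of_central hm ρ 1
      (fun _ => Subgroup.one_mem _) (SU2.mat_injective (by rw [hθ]; exact hk))
    rw [h, MonoidHom.one_apply, SU2.mat_one]
  · have h : ρ = ρ₀ := MonoidHom.eq_of_normalClosure_of_central hm ρ ρ₀
      (fun g => SU2.mem_center_of_mat (hcentral g))
      (SU2.mat_injective (by rw [hθ, hρm]; exact hk))
    rw [h, hρl]
end

section
/- Let G be a group and m, l ∈ G with l in the commutator subgroup [G,G]. Let p and q be coprime integers and suppose that every group homomorphism ρ : G → SO(3) satisfying ρ(m)^p ρ(l)^q = I has cyclic image. Then every point (θ,η) ∈ R(G,m,l) with (pθ + qη) ∈ πℤ satisfies η ∈ 2πℤ. (Equivalently, R(G,m,l) ∩ Ŝ(p/q) ⊆ {η ∈ 2πℤ}.) -/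
open Real

/-- `SO(3)`: the group of 3×3 real orthogonal matrices of determinant 1, as a subgroup of
the orthogonal group. -/
noncomputable def SO3 : Subgroup (Matrix.orthogonalGroup (Fin 3) ℝ) where
  carrier := {A | (A : Matrix (Fin 3) (Fin 3) ℝ).det = 1}
  one_mem' := by simp
  mul_mem' := by
    intro a b ha hb
    simp only [Set.mem_setOf_eq] at *
    simp only [Matrix.UnitaryGroup.mul_apply] at *
    rw [Matrix.det_mul, ha, hb, mul_one]
  inv_mem' := by
    intro a ha
    simp only [Set.mem_setOf_eq] at *
    have h : ((a⁻¹ : Matrix.orthogonalGroup (Fin 3) ℝ) : Matrix (Fin 3) (Fin 3) ℝ)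
        = star (a : Matrix (Fin 3) (Fin 3) ℝ) := rfl
    rw [h]
    simp [Matrix.star_eq_conjTranspose, Matrix.det_conjTranspose, ha]

theorem SU2.star_mat_eq_adjugate (A : SU2) : star (SU2.mat A) = (SU2.mat A).adjugate := by
  have hdet : (SU2.mat A).det = 1 := A.2
  have hunit : star (SU2.mat A) * SU2.mat A = 1 := A.1.2.1
  calc star (SU2.mat A) = star (SU2.mat A) * (SU2.mat A * (SU2.mat A).adjugate) := by
        rw [Matrix.mul_adjugate, hdet, one_smul, mul_one]
    _ = (SU2.mat A).adjugate := by rw [← mul_assoc, hunit, one_mul]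

theorem SU2.mat_one_one (A : SU2) : SU2.mat A 1 1 = star (SU2.mat A 0 0) := by
  have h := congrFun (congrFun (SU2.star_mat_eq_adjugate A) 0) 0
  simpa [Matrix.adjugate_fin_two, Matrix.star_apply] using h.symm

theorem SU2.mat_one_zero (A : SU2) : SU2.mat A 1 0 = -star (SU2.mat A 0 1) := by
  have h := congrFun (congrFun (SU2.star_mat_eq_adjugate A) 1) 0
  simp only [Matrix.adjugate_fin_two, Matrix.star_apply] at h
  rw [h]
  simp

theorem SU2.sq_add_sq_eq_one (A : SU2) :
    (SU2.mat A 0 0).re ^ 2 + (SU2.mat A 0 0).im ^ 2 + (SU2.mat A 0 1).re ^ 2 +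
      (SU2.mat A 0 1).im ^ 2 = 1 := by
  have h : (SU2.mat A).det = 1 := A.2
  rw [Matrix.det_fin_two, SU2.mat_one_one, SU2.mat_one_zero] at h
  have h' := congrArg Complex.re h
  simp at h'
  linarith

/-- The matrix of `v ↦ u v ū` on imaginary quaternions, for `u = w + xi + yj + zk`. -/
def quaternionRotation (w x y z : ℝ) : Matrix (Fin 3) (Fin 3) ℝ :=
  !![w ^ 2 + x ^ 2 - y ^ 2 - z ^ 2, 2 * (x * y - w * z), 2 * (x * z + w * y);
    2 * (x * y + w * z), w ^ 2 - x ^ 2 + y ^ 2 - z ^ 2, 2 * (y * z - w * x);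
    2 * (x * z - w * y), 2 * (y * z + w * x), w ^ 2 - x ^ 2 - y ^ 2 + z ^ 2]

theorem quaternionRotation_mul (w x y z w' x' y' z' : ℝ) :
    quaternionRotation w x y z * quaternionRotation w' x' y' z' =
      quaternionRotation (w * w' - x * x' - y * y' - z * z')
        (w * x' + x * w' + y * z' - z * y') (w * y' - x * z' + y * w' + z * x')
        (w * z' + x * y' - y * x' + z * w') := by
  ext i j
  fin_cases i <;> fin_cases j <;>
    simp [quaternionRotation, Matrix.mul_apply, Fin.sum_univ_three] <;> ring

theorem quaternionRotation_transpose (w x y z : ℝ) :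
    (quaternionRotation w x y z).transpose = quaternionRotation w (-x) (-y) (-z) := by
  ext i j
  fin_cases i <;> fin_cases j <;> simp [quaternionRotation] <;> ring

theorem quaternionRotation_one : quaternionRotation 1 0 0 0 = 1 := by
  ext i j
  fin_cases i <;> fin_cases j <;> simp [quaternionRotation]

theorem det_quaternionRotation (w x y z : ℝ) :
    (quaternionRotation w x y z).det = (w ^ 2 + x ^ 2 + y ^ 2 + z ^ 2) ^ 3 := by
  simp [quaternionRotation, Matrix.det_fin_three]
  ring

theorem quaternionRotation_mem_orthogonalGroup {w x y z : ℝ}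
    (h : w ^ 2 + x ^ 2 + y ^ 2 + z ^ 2 = 1) :
    quaternionRotation w x y z ∈ Matrix.orthogonalGroup (Fin 3) ℝ := by
  rw [Matrix.mem_orthogonalGroup_iff, quaternionRotation_transpose,
    quaternionRotation_mul, ← quaternionRotation_one]
  congr 1
  · linarith
  all_goals ring

theorem eq_zero_of_quaternionRotation_eq_one {w x y z : ℝ}
    (h : w ^ 2 + x ^ 2 + y ^ 2 + z ^ 2 = 1) (hR : quaternionRotation w x y z = 1) :
    x = 0 ∧ y = 0 ∧ z = 0 := by
  have h0 := congrFun (congrFun hR 0) 0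
  have h1 := congrFun (congrFun hR 1) 1
  have h2 := congrFun (congrFun hR 2) 2
  simp [quaternionRotation] at h0 h1 h2
  refine ⟨?_, ?_, ?_⟩ <;> apply pow_eq_zero_iff two_ne_zero |>.mp <;>
    nlinarith [sq_nonneg x, sq_nonneg y, sq_nonneg z]

/-- The double covering `SU(2) → SO(3)`. -/
noncomputable def SU2.toSO3 : SU2 →* SO3 :=
  MonoidHom.mk'
    (fun A => ⟨⟨quaternionRotation (SU2.mat A 0 0).re (SU2.mat A 0 0).im
        (SU2.mat A 0 1).re (SU2.mat A 0 1).im,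
      quaternionRotation_mem_orthogonalGroup (SU2.sq_add_sq_eq_one A)⟩, by
        change (quaternionRotation _ _ _ _).det = 1
        rw [det_quaternionRotation, SU2.sq_add_sq_eq_one A, one_pow]⟩)
    (by
      intro A B
      apply Subtype.ext
      apply Subtype.ext
      change quaternionRotation _ _ _ _ = quaternionRotation _ _ _ _ * quaternionRotation _ _ _ _
      rw [quaternionRotation_mul, SU2.mat_mul, Matrix.mul_apply, Matrix.mul_apply,
        Fin.sum_univ_two, Fin.sum_univ_two, SU2.mat_one_one, SU2.mat_one_zero]
      congr 1 <;> simp <;> ring)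

theorem SU2.coe_toSO3 (A : SU2) :
    ((SU2.toSO3 A : Matrix.orthogonalGroup (Fin 3) ℝ) : Matrix (Fin 3) (Fin 3) ℝ) =
      quaternionRotation (SU2.mat A 0 0).re (SU2.mat A 0 0).im
        (SU2.mat A 0 1).re (SU2.mat A 0 1).im := rfl

theorem SU2.ker_toSO3_le_center : SU2.toSO3.ker ≤ Subgroup.center SU2 := by
  intro A hA
  have hR : quaternionRotation (SU2.mat A 0 0).re (SU2.mat A 0 0).im
        (SU2.mat A 0 1).re (SU2.mat A 0 1).im = 1 := by
    rw [← SU2.coe_toSO3 A, MonoidHom.mem_ker.mp hA]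
    rfl
  obtain ⟨hx, hy, hz⟩ := eq_zero_of_quaternionRotation_eq_one (SU2.sq_add_sq_eq_one A) hR
  have h01 : SU2.mat A 0 1 = 0 := Complex.ext hy hz
  have h10 : SU2.mat A 1 0 = 0 := by rw [SU2.mat_one_zero A, h01, star_zero, neg_zero]
  have h11 : SU2.mat A 1 1 = SU2.mat A 0 0 := by
    rw [SU2.mat_one_one A]
    exact Complex.conj_eq_iff_im.mpr hx
  have hscalar : SU2.mat A = SU2.mat A 0 0 • (1 : Matrix (Fin 2) (Fin 2) ℂ) := by
    ext i j
    fin_cases i <;> fin_cases j <;> simp [h01, h10, h11]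
  rw [Subgroup.mem_center_iff]
  intro B
  apply SU2.mat_injective
  rw [SU2.mat_mul, SU2.mat_mul, hscalar]
  simp

theorem DSU_add (s t : ℝ) : DSU (s + t) = DSU s * DSU t := by
  apply SU2.mat_injective
  change Dmat (s + t) = Dmat s * Dmat t
  simp only [Dmat, Matrix.diagonal_mul_diagonal]
  congr 1
  ext i
  fin_cases i <;> simp [← Complex.exp_add] <;> ring_nf

/-- The one-parameter subgroup `θ ↦ D(θ)`. -/
noncomputable def DSUHom : Multiplicative ℝ →* SU2 :=
  MonoidHom.mk' (fun t => DSU t.toAdd) fun s t => DSU_add s.toAdd t.toAdd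

theorem DSU_zpow (t : ℝ) (n : ℤ) : DSU t ^ n = DSU (n * t) := by
  have h := map_zpow DSUHom (Multiplicative.ofAdd t) n
  rw [← ofAdd_zsmul, zsmul_eq_mul] at h
  exact h.symm

theorem toSO3_DSU_pi_mul_int (k : ℤ) : SU2.toSO3 (DSU (π * k)) = 1 := by
  have h : SU2.toSO3 (DSU π) = 1 := by
    apply Subtype.ext
    apply Subtype.ext
    rw [SU2.coe_toSO3]
    change quaternionRotation (Dmat π 0 0).re (Dmat π 0 0).im (Dmat π 0 1).re (Dmat π 0 1).im = 1
    rw [← quaternionRotation_one]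
    simp [Dmat, Complex.exp_pi_mul_I, quaternionRotation]
  rw [mul_comm, ← DSU_zpow, map_zpow, h, one_zpow]

theorem exists_int_of_DSU_eq_one {t : ℝ} (h : DSU t = 1) : ∃ k : ℤ, t = 2 * π * (k : ℝ) := by
  have h00 : Complex.exp (t * Complex.I) = 1 := by
    have h' := congrArg (fun A : SU2 => SU2.mat A 0 0) h
    change Dmat t 0 0 = (1 : Matrix (Fin 2) (Fin 2) ℂ) 0 0 at h'
    simpa [Dmat] using h'
  obtain ⟨k, hk⟩ := Complex.exp_eq_one_iff.mp h00
  refine ⟨k, ?_⟩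
  have him := congrArg Complex.im hk
  simp at him
  linarith

theorem commute_of_isCyclic_range_comp {G H K : Type*} [Group G] [Group H] [Group K]
    (f : H →* K) (hf : f.ker ≤ Subgroup.center H) (ρ : G →* H) (hc : IsCyclic (f.comp ρ).range)
    (a b : G) : Commute (ρ a) (ρ b) := by
  obtain ⟨⟨_, g, rfl⟩, hg⟩ := hc.exists_generator
  have key (a : G) : ∃ n : ℤ, ∃ c ∈ Subgroup.center H, ρ a = c * ρ g ^ n := by
    obtain ⟨n, hn⟩ := hg ⟨f (ρ a), a, rfl⟩
    have hn' : f (ρ g) ^ n = f (ρ a) := congrArg Subtype.val hn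
    refine ⟨n, ρ a * (ρ g ^ n)⁻¹, hf ?_, by group⟩
    rw [MonoidHom.mem_ker, map_mul, map_inv, map_zpow, hn', mul_inv_cancel]
  obtain ⟨i, c, hc, ha⟩ := key a
  obtain ⟨j, d, hd, hb⟩ := key b
  have hc' (x : H) : Commute c x := (Subgroup.mem_center_iff.mp hc x).symm
  have hd' (x : H) : Commute x d := Subgroup.mem_center_iff.mp hd x
  rw [ha, hb]
  exact (hc' _).mul_left ((hd' _).mul_right (Commute.zpow_zpow_self _ i j))

/-- Suppose `l` lies in the commutator subgroup, and `p, q` are coprime integers such that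
every `ρ : G → SO(3)` with `ρ(m)^p ρ(l)^q = I` has cyclic image (the surgery is
`SO(3)`-cyclic).  Then every `(θ,η) ∈ R(G,m,l)` with `pθ+qη ∈ πℤ` satisfies `η ∈ 2πℤ`. -/
theorem statement_5 {G : Type*} [Group G] (m l : G) (hl : l ∈ commutator G)
    (p q : ℤ) (hpq : IsCoprime p q)
    (hcyc : ∀ ρ : G →* SO3, ρ m ^ p * ρ l ^ q = 1 → IsCyclic ρ.range) :
    ∀ θ η : ℝ, (θ, η) ∈ RSet G m l →
      (∃ k : ℤ, (p : ℝ) * θ + (q : ℝ) * η = π * k) →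
      ∃ k : ℤ, η = 2 * π * (k : ℝ) := by
  rintro θ η ⟨ρ, hm, hl'⟩ ⟨k, hk⟩
  dsimp only at hm hl'
  have hcomm := commute_of_isCyclic_range_comp SU2.toSO3 SU2.ker_toSO3_le_center ρ <| hcyc _ <| by
    rw [MonoidHom.comp_apply, MonoidHom.comp_apply, hm, hl', ← map_zpow, ← map_zpow, ← map_mul,
      DSU_zpow, DSU_zpow, ← DSU_add, hk, toSO3_DSU_pi_mul_int]
  have hker : commutator G ≤ ρ.ker := by
    rw [commutator_def, Subgroup.commutator_le]
    intro a _ b _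
    rw [MonoidHom.mem_ker, map_commutatorElement, commutatorElement_eq_one_iff_commute]
    exact hcomm a b
  exact exists_int_of_DSU_eq_one (hl'.symm.trans (MonoidHom.mem_ker.mp (hker hl)))
end
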